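/- Let K ∈ ℝ, N ∈ [1,∞), let (X,d,m) be a CD*(K,N) metric measure space having the good transport property (GT), and let mu, nu ∈ P2(X) have bounded support with mu <= C*m for some constant C > 0. Then there exists pi ∈ OptGeo(mu,nu) such that (e_t)#pi is absolutely continuous with respect to m for every t ∈ [0,1). -/

import Mathlib

open MeasureTheory Metric Set unitInterval ENNReal NNReal

noncomputable section

variable {X : Type*} [MetricSpace X]

/-- A constant speed minimizing geodesic parametrized on `[0,1]`. -/
def IsUnitGeodesic (γ : C(unitInterval, X)) : Prop :=
  ∀ s t : unitInterval, dist (γ s) (γ t) = |(s : ℝ) - (t : ℝ)| * dist (γ 0) (γ 1)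

/-- The space of constant speed minimizing geodesics, with the sup distance. -/
def Geo (X : Type*) [MetricSpace X] : Type _ :=
  { γ : C(unitInterval, X) // IsUnitGeodesic γ }

instance : MetricSpace (Geo X) := Subtype.metricSpace
instance : MeasurableSpace (Geo X) := borel _
instance : BorelSpace (Geo X) := ⟨rfl⟩

/-- Evaluation map `e_t`. -/
def eval (t : unitInterval) (γ : Geo X) : X := γ.1 t

/-- `(X,d)` is a geodesic space: any two points are joined by a geodesic. -/
def IsGeodesicSpace (X : Type*) [MetricSpace X] : Prop :=
  ∀ x y : X, ∃ γ : Geo X, eval 0 γ = x ∧ eval 1 γ = y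

/-- The (topological) support of a measure. -/
def measSupport {Y : Type*} [TopologicalSpace Y] [MeasurableSpace Y] (μ : Measure Y) : Set Y :=
  {y | ∀ U ∈ nhds y, 0 < μ U}

variable [MeasurableSpace X]

/-- Finite second moment. -/
def HasFiniteSecondMoment (μ : Measure X) : Prop :=
  ∃ x₀ : X, ∫⁻ x, ENNReal.ofReal (dist x x₀ ^ 2) ∂μ ≠ ⊤

/-- The transport cost of a plan on the space of geodesics. -/
def transportCost (π : Measure (Geo X)) : ℝ≥0∞ :=
  ∫⁻ γ, ENNReal.ofReal (dist (eval 0 γ) (eval 1 γ) ^ 2) ∂π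

/-- `π ∈ OptGeo(μ,ν)`: an optimal geodesic plan from `μ` to `ν`. -/
def IsOptGeo (μ ν : Measure X) (π : Measure (Geo X)) : Prop :=
  IsProbabilityMeasure π ∧ π.map (eval 0) = μ ∧ π.map (eval 1) = ν ∧
    ∀ π' : Measure (Geo X), IsProbabilityMeasure π' →
      π'.map (eval 0) = μ → π'.map (eval 1) = ν →
      transportCost π ≤ transportCost π'

/-- The distortion coefficients `σ_{K,N}^{(t)}(θ)`. -/
def sigmaCoeff (K N t θ : ℝ) : ℝ≥0∞ :=
  if N * Real.pi ^ 2 ≤ K * θ ^ 2 then ⊤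
  else if 0 < K * θ ^ 2 then
    ENNReal.ofReal (Real.sin (t * θ * Real.sqrt (K / N)) / Real.sin (θ * Real.sqrt (K / N)))
  else if K * θ ^ 2 = 0 then ENNReal.ofReal t
  else ENNReal.ofReal (Real.sinh (t * θ * Real.sqrt (-K / N)) / Real.sinh (θ * Real.sqrt (-K / N)))

/-- The distortion coefficients `τ_{K,N}^{(t)}(θ)`. -/
def tauCoeff (K N t θ : ℝ) : ℝ≥0∞ :=
  if N = 1 then
    (if K ≤ 0 then ENNReal.ofReal t else if θ = 0 then ENNReal.ofReal t else ⊤)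
  else ENNReal.ofReal t ^ (1 / N) * sigmaCoeff K (N - 1) t θ ^ ((N - 1) / N)

/-- The (reduced) curvature dimension condition `CD*(K,N)`. -/
def IsCDStar (K N : ℝ) (m : Measure X) : Prop :=
  ∀ μ₀ μ₁ : Measure X, IsProbabilityMeasure μ₀ → IsProbabilityMeasure μ₁ →
    (∃ s : Set X, Bornology.IsBounded s ∧ μ₀ sᶜ = 0 ∧ μ₁ sᶜ = 0) →
    ∃ π : Measure (Geo X), IsOptGeo μ₀ μ₁ π ∧
      ∀ t : unitInterval, ∀ N' : ℝ, N ≤ N' →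
        ∫⁻ γ, (sigmaCoeff K N' (1 - (t : ℝ)) (dist (eval 0 γ) (eval 1 γ)) *
                 ((π.map (eval 0)).rnDeriv m (eval 0 γ)) ^ (-(1 / N')) +
               sigmaCoeff K N' (t : ℝ) (dist (eval 0 γ) (eval 1 γ)) *
                 ((π.map (eval 1)).rnDeriv m (eval 1 γ)) ^ (-(1 / N'))) ∂π
          ≤ ∫⁻ x, ((π.map (eval t)).rnDeriv m x) ^ (1 - 1 / N') ∂m

/-- The good transport property (GT): between absolutely continuous measures in `P₂(X)` there is
a unique optimal geodesic plan, and it is induced by a map from every intermediate time. -/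
def GoodTransport (m : Measure X) : Prop :=
  ∀ μ ν : Measure X, IsProbabilityMeasure μ → IsProbabilityMeasure ν →
    HasFiniteSecondMoment μ → HasFiniteSecondMoment ν → μ ≪ m → ν ≪ m →
    (∃! π : Measure (Geo X), IsOptGeo μ ν π) ∧
    ∀ π : Measure (Geo X), IsOptGeo μ ν π → ∀ t : unitInterval,
      ∃ T : X → Geo X, Measurable T ∧ π = (π.map (eval t)).map T

/-- `c`-concavity (with `c = d²/2`) for functions with values in `ℝ ∪ {-∞}`. -/
def cConcave (φ : X → EReal) : Prop :=
  (∃ x, φ x ≠ ⊥) ∧ (∀ x, φ x ≠ ⊤) ∧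
    ∃ ψ : X → EReal, (∀ y, ψ y ≠ ⊤) ∧
      ∀ x, φ x = ⨅ y, ((dist x y ^ 2 / 2 : ℝ) : EReal) - ψ y

/-- The `c`-transform `φᶜ`. -/
def cTransform (φ : X → EReal) : X → EReal :=
  fun y => ⨅ x, ((dist x y ^ 2 / 2 : ℝ) : EReal) - φ x

/-- The `c`-superdifferential `∂ᶜφ`. -/
def cSuperdiff (φ : X → EReal) : Set (X × X) :=
  {p | φ p.1 + cTransform φ p.2 = ((dist p.1 p.2 ^ 2 / 2 : ℝ) : EReal)}

/-- Kantorovich potential from `μ` to `ν`. -/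
def IsKantorovichPotential (μ ν : Measure X) (φ : X → EReal) : Prop :=
  cConcave φ ∧ ∀ π : Measure (Geo X), IsOptGeo μ ν π →
    measSupport (π.map (fun γ => (eval 0 γ, eval 1 γ))) ⊆ cSuperdiff φ

set_option linter.unusedSectionVars false

section Aux

open Filter Topology ProbabilityTheory

lemma aux_sigma_lb (K N' u θ D : ℝ) (hN : 0 < N') (hu0 : 0 ≤ u) (hu1 : u ≤ 1) (hθ : 0 ≤ θ)
    (hD : θ ≤ D) :
    ENNReal.ofReal (u / Real.cosh (D * Real.sqrt (-K / N'))) ≤ sigmaCoeff K N' u θ := by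
  have hc1 : 1 ≤ Real.cosh (D * Real.sqrt (-K / N')) := Real.one_le_cosh _
  have hle : u / Real.cosh (D * Real.sqrt (-K / N')) ≤ u := div_le_self hu0 hc1
  unfold sigmaCoeff
  split_ifs with h1 h2 h3
  · exact le_top
  · apply ENNReal.ofReal_le_ofReal
    refine hle.trans ?_
    have hK : 0 < K := by
      by_contra hK
      push Not at hK
      nlinarith [sq_nonneg θ]
    have hθ' : 0 < θ := by
      rcases hθ.eq_or_lt with h | h
      · rw [← h] at h2; simp at h2
      · exact h
    set a := Real.sqrt (K / N') with ha
    have ha0 : 0 < a := Real.sqrt_pos.2 (div_pos hK hN)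
    have ha2 : a ^ 2 = K / N' := Real.sq_sqrt (div_pos hK hN).le
    have hx0 : 0 < θ * a := mul_pos hθ' ha0
    have hxpi : θ * a < Real.pi := by
      apply lt_of_pow_lt_pow_left₀ 2 Real.pi_pos.le
      rw [mul_pow, ha2]
      push Not at h1
      rw [← mul_div_assoc, div_lt_iff₀ hN]
      linarith
    rw [le_div_iff₀ (Real.sin_pos_of_pos_of_lt_pi hx0 hxpi)]
    have h0m : (0:ℝ) ∈ Icc 0 Real.pi := ⟨le_rfl, Real.pi_pos.le⟩
    have hxm : θ * a ∈ Icc 0 Real.pi := ⟨hx0.le, hxpi.le⟩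
    have := strictConcaveOn_sin_Icc.concaveOn.2 h0m hxm (sub_nonneg.2 hu1) hu0 (by ring)
    simpa [mul_assoc] using this
  · exact ENNReal.ofReal_le_ofReal hle
  · apply ENNReal.ofReal_le_ofReal
    have hKθ : K * θ ^ 2 < 0 := lt_of_le_of_ne (not_lt.1 h2) h3
    have hK : K < 0 := by
      by_contra hK
      push Not at hK
      nlinarith [sq_nonneg θ, mul_nonneg hK (sq_nonneg θ)]
    have hθ' : 0 < θ := by
      rcases hθ.eq_or_lt with h | h
      · rw [← h] at hKθ; simp at hKθ
      · exact h
    set a := Real.sqrt (-K / N') with ha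
    have ha0 : 0 < a := Real.sqrt_pos.2 (div_pos (by linarith) hN)
    have hx0 : 0 < θ * a := mul_pos hθ' ha0
    have hs : 0 < Real.sinh (θ * a) := Real.sinh_pos_iff.2 hx0
    have h4 : Real.sinh (θ * a) ≤ (θ * a) * Real.cosh (θ * a) := by
      have hmono : MonotoneOn (fun x : ℝ => x * Real.cosh x - Real.sinh x) (Ici 0) := by
        apply monotoneOn_of_deriv_nonneg (convex_Ici 0)
        · fun_prop
        · fun_prop
        · intro x hx
          simp only [interior_Ici, mem_Ioi] at hx
          have : HasDerivAt (fun x : ℝ => x * Real.cosh x - Real.sinh x)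
              (1 * Real.cosh x + x * Real.sinh x - Real.cosh x) x :=
            ((hasDerivAt_id x).mul (Real.hasDerivAt_cosh x)).sub (Real.hasDerivAt_sinh x)
          rw [this.deriv]
          have := Real.sinh_pos_iff.2 hx
          nlinarith
      have := hmono (self_mem_Ici (a := (0:ℝ))) hx0.le hx0.le
      simp at this
      linarith
    have h5 : Real.cosh (θ * a) ≤ Real.cosh (D * a) := by
      rw [Real.cosh_le_cosh, abs_of_pos hx0, abs_of_nonneg (by nlinarith)]
      nlinarith
    have h6 : u * θ * a ≤ Real.sinh (u * θ * a) := Real.self_le_sinh_iff.2 (by positivity)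
    rw [div_le_div_iff₀ (by linarith) hs]
    calc u * Real.sinh (θ * a) ≤ u * ((θ * a) * Real.cosh (θ * a)) := by gcongr
      _ ≤ u * ((θ * a) * Real.cosh (D * a)) := by gcongr
      _ = (u * θ * a) * Real.cosh (D * a) := by ring
      _ ≤ _ := by gcongr


lemma aux_eval_cont (t : unitInterval) : Continuous (eval t : Geo X → X) := by
  unfold eval
  exact (continuous_eval_const t).comp continuous_subtype_val

lemma aux_eval_meas [BorelSpace X] (t : unitInterval) : Measurable (eval t : Geo X → X) :=
  (aux_eval_cont t).measurable


lemma aux_cost_cont : Continuous (fun γ : Geo X => dist (eval 0 γ) (eval 1 γ) ^ 2) :=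
  ((aux_eval_cont 0).dist (aux_eval_cont 1)).pow 2

lemma aux_cost_add (π π' : Measure (Geo X)) :
    transportCost (π + π') = transportCost π + transportCost π' :=
  lintegral_add_measure _ _ _

lemma aux_cost_smul (c : ℝ≥0∞) (π : Measure (Geo X)) :
    transportCost (c • π) = c * transportCost π := by
  simp [transportCost, lintegral_smul_measure]

lemma aux_cost_le [BorelSpace X] (π : Measure (Geo X)) [IsProbabilityMeasure π] (s : Set X) (D : ℝ)
    (hD : ∀ x ∈ s, ∀ y ∈ s, dist x y ≤ D)
    (h0 : π.map (eval 0) sᶜ = 0) (h1 : π.map (eval 1) sᶜ = 0) :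
    (∀ᵐ γ ∂π, dist (eval 0 γ) (eval 1 γ) ≤ D) ∧ transportCost π ≠ ⊤ := by
  have e0 : ∀ᵐ γ ∂π, eval 0 γ ∈ s :=
    ae_of_ae_map (aux_eval_meas 0).aemeasurable (p := fun x => x ∈ s) h0
  have e1 : ∀ᵐ γ ∂π, eval 1 γ ∈ s :=
    ae_of_ae_map (aux_eval_meas 1).aemeasurable (p := fun x => x ∈ s) h1
  have h : ∀ᵐ γ ∂π, dist (eval 0 γ) (eval 1 γ) ≤ D := by
    filter_upwards [e0, e1] with γ a b using hD _ a _ b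
  refine ⟨h, ?_⟩
  have : transportCost π ≤ ∫⁻ γ, ENNReal.ofReal (D ^ 2) ∂π := by
    apply lintegral_mono_ae
    filter_upwards [h] with γ hγ
    gcongr
  refine ne_top_of_le_ne_top ?_ this
  simp

lemma aux_restrict [BorelSpace X] {μ ν : Measure X} {π : Measure (Geo X)} (h : IsOptGeo μ ν π)
    (hfin : transportCost π ≠ ⊤) (Γ : Set (Geo X)) (hΓ : MeasurableSet Γ) (hp : π Γ ≠ 0) :
    IsOptGeo ((ProbabilityTheory.cond π Γ).map (eval 0)) ((ProbabilityTheory.cond π Γ).map (eval 1)) (ProbabilityTheory.cond π Γ) := by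
  obtain ⟨hprob, h0, h1, hopt⟩ := h
  have hpt : π Γ ≠ ⊤ := measure_ne_top _ _
  have hcond : π Γ • ProbabilityTheory.cond π Γ = π.restrict Γ := by
    rw [ProbabilityTheory.cond, smul_smul, ENNReal.mul_inv_cancel hp hpt, one_smul]
  refine ⟨cond_isProbabilityMeasure hp, rfl, rfl, ?_⟩
  intro π' hπ' h0' h1'
  have key : ∀ t : unitInterval, π'.map (eval t) = (ProbabilityTheory.cond π Γ).map (eval t) →
      (π Γ • π' + π.restrict Γᶜ).map (eval t) = π.map (eval t) := by
    intro t ht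
    rw [Measure.map_add _ _ (aux_eval_meas t), Measure.map_smul, ht, ← Measure.map_smul, hcond,
      ← Measure.map_add _ _ (aux_eval_meas t), Measure.restrict_add_restrict_compl hΓ]
  have hc := hopt (π Γ • π' + π.restrict Γᶜ) ⟨by
      simp only [Measure.coe_add, Measure.coe_smul, Pi.add_apply, Pi.smul_apply, measure_univ,
        smul_eq_mul, mul_one, Measure.restrict_apply MeasurableSet.univ, univ_inter]
      rw [measure_add_measure_compl hΓ, measure_univ]⟩
    ((key 0 h0').trans h0) ((key 1 h1').trans h1)
  have hdec : transportCost π = π Γ * transportCost (ProbabilityTheory.cond π Γ) + transportCost (π.restrict Γᶜ) := by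
    rw [← aux_cost_smul, hcond, ← aux_cost_add, Measure.restrict_add_restrict_compl hΓ]
  rw [hdec, aux_cost_add, aux_cost_smul] at hc
  rw [hdec] at hfin
  have := ENNReal.le_of_add_le_add_right (ENNReal.add_ne_top.1 hfin).2 hc
  exact (ENNReal.mul_le_mul_iff_right hp hpt).1 this

lemma aux_moment (μ : Measure X) [IsProbabilityMeasure μ] (s : Set X)
    (hs : Bornology.IsBounded s) (h : μ sᶜ = 0) : HasFiniteSecondMoment μ := by
  obtain ⟨x₀⟩ : Nonempty X := nonempty_of_isProbabilityMeasure μ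
  obtain ⟨R, hR⟩ := hs.subset_closedBall x₀
  refine ⟨x₀, ?_⟩
  have : ∫⁻ x, ENNReal.ofReal (dist x x₀ ^ 2) ∂μ ≤ ∫⁻ x, ENNReal.ofReal (R ^ 2) ∂μ := by
    apply lintegral_mono_ae
    have h' : ∀ᵐ x ∂μ, x ∈ s := h
    filter_upwards [h'] with x hx
    have : dist x x₀ ≤ R := hR hx
    gcongr
  refine ne_top_of_le_ne_top ?_ this
  simp

lemma aux_holder (m δ : Measure X) [IsProbabilityMeasure δ] (A : Set X) (hA : MeasurableSet A)
    (hδ : δ Aᶜ = 0) (N' : ℝ) (hN : 1 < N') :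
    ∫⁻ x, (δ.rnDeriv m x) ^ (1 - 1 / N') ∂m ≤ (m A) ^ (1 / N') := by
  have hN0 : 0 < N' := by linarith
  have hq : 1 / N' < 1 := by rw [div_lt_one hN0]; exact hN
  have h0 : ∀ᵐ x ∂(m.restrict Aᶜ), δ.rnDeriv m x = 0 := by
    have : ∫⁻ x in Aᶜ, δ.rnDeriv m x ∂m = 0 :=
      le_antisymm ((Measure.setLIntegral_rnDeriv_le _).trans hδ.le) (zero_le)
    exact (lintegral_eq_zero_iff (Measure.measurable_rnDeriv _ _)).1 this
  rw [← lintegral_add_compl _ hA]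
  have h1 : ∫⁻ x in Aᶜ, (δ.rnDeriv m x) ^ (1 - 1 / N') ∂m = 0 := by
    rw [lintegral_eq_zero_iff ((Measure.measurable_rnDeriv _ _).pow_const _)]
    filter_upwards [h0] with x hx
    rw [hx, ENNReal.zero_rpow_of_pos (by linarith)]
    rfl
  rw [h1, add_zero]
  have := ENNReal.lintegral_mul_norm_pow_le (μ := m.restrict A)
    (Measure.measurable_rnDeriv δ m).aemeasurable (aemeasurable_const (b := (1 : ℝ≥0∞)))
    (p := 1 - 1 / N') (q := 1 / N') (by linarith) (by positivity) (by ring)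
  simp only [ENNReal.one_rpow, mul_one, lintegral_const, Measure.restrict_apply MeasurableSet.univ,
    univ_inter, one_mul] at this
  refine this.trans ?_
  calc _ ≤ (1 : ℝ≥0∞) ^ (1 - 1 / N') * (m A) ^ (1 / N') := by
        gcongr
        exact (Measure.setLIntegral_rnDeriv_le _).trans prob_le_one
    _ = _ := by simp

lemma aux_rnDeriv_le (m α : Measure X) [SigmaFinite m] (c : ℝ≥0∞)
    (h : α ≤ c • m) : ∀ᵐ x ∂m, α.rnDeriv m x ≤ c := by
  apply ae_le_of_forall_setLIntegral_le_of_sigmaFinite (Measure.measurable_rnDeriv _ _)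
  intro s hs _
  refine (Measure.setLIntegral_rnDeriv_le _).trans ((h s).trans ?_)
  simp

lemma aux_density [BorelSpace X] (m : Measure X) [SigmaFinite m]
    (K N : ℝ) (hN : 1 ≤ N) (hCD : IsCDStar K N m) (hGT : GoodTransport m)
    (μ ν : Measure X) (s : Set X) (hs : Bornology.IsBounded s) (hμs : μ sᶜ = 0) (hνs : ν sᶜ = 0)
    (D : ℝ) (hD : ∀ x ∈ s, ∀ y ∈ s, dist x y ≤ D)
    (C : ℝ) (hC : 0 < C) (hμC : μ ≤ ENNReal.ofReal C • m) (hν : ν ≪ m)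
    (π : Measure (Geo X)) (hπ : IsOptGeo μ ν π) (t : unitInterval) (A : Set X)
    (hA : MeasurableSet A) :
    ENNReal.ofReal ((1 - (t : ℝ)) / Real.cosh (D * Real.sqrt (-K / (N + 1)))) ^ (N + 1) *
      (π.map (eval t) A) ≤ ENNReal.ofReal C * m A := by
  set c := ENNReal.ofReal ((1 - (t : ℝ)) / Real.cosh (D * Real.sqrt (-K / (N + 1)))) with hc
  obtain ⟨hprob, h0, h1, hopt⟩ := id hπ
  have hN1 : 0 < N + 1 := by linarith
  rw [Measure.map_apply (aux_eval_meas t) hA]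
  set Γ := (eval t : Geo X → X) ⁻¹' A with hΓdef
  have hΓ : MeasurableSet Γ := aux_eval_meas t hA
  by_cases hp : π Γ = 0
  · rw [hp]; simp
  have hpt : π Γ ≠ ⊤ := measure_ne_top _ _
  obtain ⟨hdist, hfin⟩ := aux_cost_le π s D hD (by rw [h0]; exact hμs) (by rw [h1]; exact hνs)
  have hres := aux_restrict hπ hfin Γ hΓ hp
  have hcprob := hres.1
  set κ := ProbabilityTheory.cond π Γ with hκ
  have hκle : κ ≤ (π Γ)⁻¹ • π := by
    rw [hκ, ProbabilityTheory.cond]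
    gcongr
    exact Measure.restrict_le_self
  have hκac : κ ≪ π := ProbabilityTheory.cond_absolutelyContinuous
  have hmle : ∀ r : unitInterval, κ.map (eval r) ≤ (π Γ)⁻¹ • π.map (eval r) := by
    intro r
    rw [← Measure.map_smul]
    exact Measure.map_mono hκle (aux_eval_meas r)
  have hacm : ∀ r : unitInterval, κ.map (eval r) ≪ π.map (eval r) := fun r =>
    hκac.map (aux_eval_meas r)
  have hp0 : IsProbabilityMeasure (κ.map (eval 0)) :=
    Measure.isProbabilityMeasure_map (aux_eval_meas 0).aemeasurable
  have hp1 : IsProbabilityMeasure (κ.map (eval 1)) :=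
    Measure.isProbabilityMeasure_map (aux_eval_meas 1).aemeasurable
  have hpt' : IsProbabilityMeasure (κ.map (eval t)) :=
    Measure.isProbabilityMeasure_map (aux_eval_meas t).aemeasurable
  have hs0 : κ.map (eval 0) sᶜ = 0 := hacm 0 (by rw [h0]; exact hμs)
  have hs1 : κ.map (eval 1) sᶜ = 0 := hacm 1 (by rw [h1]; exact hνs)
  have hμm : μ ≪ m := Measure.absolutelyContinuous_of_le_smul hμC
  have ha0 : κ.map (eval 0) ≪ m := (hacm 0).trans (by rw [h0]; exact hμm)
  have ha1 : κ.map (eval 1) ≪ m := (hacm 1).trans (by rw [h1]; exact hν)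
  obtain ⟨η, hη, hineq⟩ := hCD _ _ hp0 hp1 ⟨s, hs, hs0, hs1⟩
  have hηκ : η = κ := (hGT _ _ hp0 hp1 (aux_moment _ s hs hs0) (aux_moment _ s hs hs1) ha0
    ha1).1.unique hη hres
  rw [hηκ] at hineq
  have hI := hineq t (N + 1) (by linarith)
  set q : ℝ := 1 / (N + 1) with hq
  have hq0 : 0 < q := by positivity
  set B : ℝ≥0∞ := (π Γ)⁻¹ * ENNReal.ofReal C with hB
  have hle0 : κ.map (eval 0) ≤ B • m := by
    refine (hmle 0).trans ?_
    rw [h0, hB, mul_smul]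
    gcongr
  have hrn : ∀ᵐ γ ∂κ, (κ.map (eval 0)).rnDeriv m (eval 0 γ) ≤ B :=
    ae_of_ae_map (aux_eval_meas 0).aemeasurable
      (p := fun x => (κ.map (eval 0)).rnDeriv m x ≤ B) (ha0.ae_le (aux_rnDeriv_le m _ B hle0))
  have hlow : c * B ^ (-q) ≤ ∫⁻ γ, (sigmaCoeff K (N + 1) (1 - (t : ℝ)) (dist (eval 0 γ) (eval 1 γ)) *
                 ((κ.map (eval 0)).rnDeriv m (eval 0 γ)) ^ (-q) +
               sigmaCoeff K (N + 1) (t : ℝ) (dist (eval 0 γ) (eval 1 γ)) *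
                 ((κ.map (eval 1)).rnDeriv m (eval 1 γ)) ^ (-q)) ∂κ := by
    calc c * B ^ (-q) = ∫⁻ γ, c * B ^ (-q) ∂κ := by simp
      _ ≤ _ := by
        apply lintegral_mono_ae
        filter_upwards [hrn, hκac.ae_le hdist] with γ hγ hd
        refine le_trans ?_ le_self_add
        gcongr ?_ * ?_
        · exact aux_sigma_lb K (N + 1) _ _ D hN1 (by linarith [t.2.2]) (by linarith [t.2.1])
            dist_nonneg hd
        · rw [ENNReal.rpow_neg, ENNReal.rpow_neg]
          gcongr
  have hup := aux_holder m (κ.map (eval t)) A hA (by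
    rw [Measure.map_apply (aux_eval_meas t) hA.compl, preimage_compl, hκ,
      ProbabilityTheory.cond_apply hΓ, ← hΓdef]
    simp) (N + 1) (by linarith)
  have hfinal := (hlow.trans hI).trans hup
  have hBt : B ≠ ⊤ := ENNReal.mul_ne_top (ENNReal.inv_ne_top.2 hp) ENNReal.ofReal_ne_top
  have hpow : (c * B ^ (-q)) ^ (N + 1) ≤ ((m A) ^ q) ^ (N + 1) :=
    ENNReal.rpow_le_rpow hfinal hN1.le
  have hqN : q * (N + 1) = 1 := by rw [hq]; field_simp
  rw [ENNReal.mul_rpow_of_nonneg _ _ hN1.le, ← ENNReal.rpow_mul, ← ENNReal.rpow_mul, neg_mul, hqN,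
    ENNReal.rpow_one, ENNReal.rpow_neg, ENNReal.rpow_one] at hpow
  have hC0 : ENNReal.ofReal C ≠ 0 := by simpa using hC
  have hBinv : B⁻¹ = π Γ * (ENNReal.ofReal C)⁻¹ := by
    rw [hB, ENNReal.mul_inv (Or.inr ENNReal.ofReal_ne_top) (Or.inr hC0), inv_inv]
  rw [hBinv] at hpow
  calc c ^ (N + 1) * π Γ
      = ENNReal.ofReal C * (c ^ (N + 1) * (π Γ * (ENNReal.ofReal C)⁻¹)) := by
        calc c ^ (N + 1) * π Γ
            = (ENNReal.ofReal C * (ENNReal.ofReal C)⁻¹) * (c ^ (N + 1) * π Γ) := by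
              rw [ENNReal.mul_inv_cancel hC0 ENNReal.ofReal_ne_top, one_mul]
          _ = _ := by ring
    _ ≤ _ := by gcongr

/-- Existence of a plan between finite measures of equal mass. -/
lemma aux_exists_plan [BorelSpace X] (m : Measure X) (K N : ℝ) (hCD : IsCDStar K N m)
    (α β : Measure X) [IsFiniteMeasure α] [IsProbabilityMeasure β]
    (s : Set X) (hs : Bornology.IsBounded s) (hα : α sᶜ = 0) (hβ : β sᶜ = 0) :
    ∃ π : Measure (Geo X), π.map (eval 0) = α ∧ π.map (eval 1) = α univ • β := by
  by_cases h0 : α univ = 0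
  · refine ⟨0, ?_, ?_⟩
    · rw [Measure.measure_univ_eq_zero.1 h0]; simp
    · rw [h0]; simp
  have ht : α univ ≠ ⊤ := measure_ne_top _ _
  have hp : IsProbabilityMeasure ((α univ)⁻¹ • α) := ⟨by
    simp [ENNReal.inv_mul_cancel h0 ht]⟩
  obtain ⟨π, hπ, -⟩ := hCD ((α univ)⁻¹ • α) β hp inferInstance ⟨s, hs, by simp [hα], hβ⟩
  refine ⟨α univ • π, ?_, ?_⟩
  · rw [Measure.map_smul, hπ.2.1, smul_smul, ENNReal.mul_inv_cancel h0 ht, one_smul]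
  · rw [Measure.map_smul, hπ.2.2.1]

/-- Absolutely continuous approximations of `ν`. -/
lemma aux_approx [BorelSpace X] [TopologicalSpace.SeparableSpace X] [Nonempty X] (m : Measure X)
    (hm_bdd : ∀ s : Set X, Bornology.IsBounded s → m s ≠ ⊤)
    (hm_supp : ∀ x : X, ∀ r : ℝ, 0 < r → 0 < m (ball x r))
    (K N : ℝ) (hCD : IsCDStar K N m)
    (ν : Measure X) [IsProbabilityMeasure ν] (s : Set X) (hs : Bornology.IsBounded s)
    (hνs : ν sᶜ = 0) (ε : ℝ) (hε : 0 < ε) :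
    ∃ ν' : Measure X, IsProbabilityMeasure ν' ∧ ν' ≪ m ∧ ν' (thickening (2 * ε) s)ᶜ = 0 ∧
      (∀ B, MeasurableSet B → ν B ≤ ν' (thickening (2 * ε) B)) ∧
      ∀ π : Measure (Geo X), IsProbabilityMeasure π → π.map (eval 0) sᶜ = 0 →
        π.map (eval 1) = ν →
        ∃ π' : Measure (Geo X), IsProbabilityMeasure π' ∧ π'.map (eval 0) = π.map (eval 0) ∧
          π'.map (eval 1) = ν' ∧
          transportCost π' ≤ ∫⁻ γ, ENNReal.ofReal ((dist (eval 0 γ) (eval 1 γ) + 4 * ε) ^ 2) ∂π := by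
  have hsec : SecondCountableTopology X := UniformSpace.secondCountable_of_separable X
  set e := TopologicalSpace.denseSeq X with he
  have hex : ∀ x : X, ∃ n, dist x (e n) < ε := fun x => by
    obtain ⟨n, hn⟩ := (TopologicalSpace.denseRange_denseSeq X).exists_dist_lt x hε
    exact ⟨n, hn⟩
  classical
  let g : X → ℕ := fun x => Nat.find (hex x)
  have hg : ∀ x, dist x (e (g x)) < ε := fun x => Nat.find_spec (hex x)
  have hgm : Measurable g := measurable_find hex (fun k => measurableSet_lt
    (measurable_id.dist measurable_const) measurable_const)
  let b : ℕ → Measure X := fun j => ProbabilityTheory.cond m (ball (e j) ε)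
  have hb : ∀ j, IsProbabilityMeasure (b j) := fun j =>
    ProbabilityTheory.cond_isProbabilityMeasure_of_finite (hm_supp _ _ hε).ne'
      (hm_bdd _ isBounded_ball)
  have hbm : ∀ j, b j ≪ m := fun j => ProbabilityTheory.cond_absolutelyContinuous
  have hbb : ∀ j, b j (ball (e j) ε)ᶜ = 0 := fun j => by
    simp only [b]
    rw [ProbabilityTheory.cond_apply measurableSet_ball]
    simp
  have hfib : ∀ j, MeasurableSet (g ⁻¹' {j}) := fun j => hgm (measurableSet_singleton j)
  have htot : ∀ B, MeasurableSet B → ∑' j, ν (B ∩ g ⁻¹' {j}) = ν B := by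
    intro B hB
    rw [← measure_iUnion]
    · congr 1
      ext x; simp
    · intro i j hij
      rw [Function.onFun, Set.disjoint_left]
      rintro x ⟨_, hx⟩ ⟨_, hx'⟩
      exact hij (hx.symm.trans hx')
    · exact fun j => hB.inter (hfib j)
  refine ⟨Measure.sum fun j => ν (g ⁻¹' {j}) • b j, ?_, ?_, ?_, ?_, ?_⟩
  · constructor
    rw [Measure.sum_apply _ MeasurableSet.univ]
    simp only [Measure.smul_apply, measure_univ, smul_eq_mul, mul_one]
    have := htot univ MeasurableSet.univ
    simpa using this
  · intro A hA
    rw [Measure.sum_apply_of_countable]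
    simp [hbm _ hA]
  · rw [Measure.sum_apply_of_countable, ENNReal.tsum_eq_zero]
    intro j
    by_cases hj : ν (g ⁻¹' {j}) = 0
    · simp [hj]
    · have : ∃ x ∈ s, g x = j := by
        by_contra hcon
        push Not at hcon
        exact hj (measure_mono_null (fun x hx hxs => hcon x hxs hx) hνs)
      obtain ⟨x, hxs, rfl⟩ := this
      have : b (g x) (thickening (2 * ε) s)ᶜ = 0 := by
        refine measure_mono_null (compl_subset_compl.2 ?_) (hbb (g x))
        intro z hz
        rw [mem_thickening_iff]
        refine ⟨x, hxs, ?_⟩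
        have := hg x
        rw [mem_ball] at hz
        linarith [dist_triangle_right z x (e (g x))]
      simp [this]
  · intro B hB
    rw [Measure.sum_apply_of_countable, ← htot B hB]
    refine ENNReal.tsum_le_tsum fun j => ?_
    by_cases hj : (B ∩ g ⁻¹' {j}).Nonempty
    · obtain ⟨x, hxB, rfl⟩ := hj
      have h1 : b (g x) (thickening (2 * ε) B) = 1 := by
        rw [← prob_compl_eq_zero_iff isOpen_thickening.measurableSet]
        refine measure_mono_null (compl_subset_compl.2 ?_) (hbb (g x))
        intro z hz
        rw [mem_thickening_iff]
        refine ⟨x, hxB, ?_⟩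
        have := hg x
        rw [mem_ball] at hz
        linarith [dist_triangle_right z x (e (g x))]
      rw [Measure.smul_apply, h1, smul_eq_mul, mul_one]
      exact measure_mono inter_subset_right
    · rw [not_nonempty_iff_eq_empty.1 hj]; simp
  · intro π hπ h0 h1
    let G : Geo X → ℕ × ℕ := fun γ => (g (eval 0 γ), g (eval 1 γ))
    have hG : Measurable G := (hgm.comp (aux_eval_meas 0)).prodMk (hgm.comp (aux_eval_meas 1))
    have hGf : ∀ q, MeasurableSet (G ⁻¹' {q}) := fun q => hG (measurableSet_singleton q)
    have hdec : π = Measure.sum fun q => π.restrict (G ⁻¹' {q}) := by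
      rw [← Measure.restrict_iUnion _ hGf]
      · have : (⋃ q, G ⁻¹' {q}) = univ := by ext γ; simp
        rw [this, Measure.restrict_univ]
      · intro i j hij
        rw [Function.onFun, Set.disjoint_left]
        intro x hx hx'
        exact hij (hx.symm.trans hx')
    have hplan : ∀ q : ℕ × ℕ, ∃ η : Measure (Geo X),
        η.map (eval 0) = (π.restrict (G ⁻¹' {q})).map (eval 0) ∧
        η.map (eval 1) = π (G ⁻¹' {q}) • b q.2 := by
      intro q
      obtain ⟨η, ha, hb'⟩ := aux_exists_plan m K N hCD ((π.restrict (G ⁻¹' {q})).map (eval 0)) (b q.2)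
        (s ∪ ball (e q.2) ε) (hs.union isBounded_ball)
        (by
          refine measure_mono_null (compl_subset_compl.2 subset_union_left) ?_
          exact (Measure.restrict_le_self.absolutelyContinuous.map (aux_eval_meas 0)) h0)
        (measure_mono_null (compl_subset_compl.2 subset_union_right) (hbb _))
      refine ⟨η, ha, ?_⟩
      rw [hb', Measure.map_apply (aux_eval_meas 0) MeasurableSet.univ]
      simp
    choose η hη0 hη1 using hplan
    refine ⟨Measure.sum η, ?_, ?_, ?_, ?_⟩
    · constructor
      have : (Measure.sum η) univ = (π.map (eval 0)) univ := by
        rw [Measure.sum_apply _ MeasurableSet.univ]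
        conv_rhs => rw [hdec, Measure.map_sum (aux_eval_meas 0).aemeasurable,
          Measure.sum_apply _ MeasurableSet.univ]
        congr 1
        ext q
        rw [← hη0 q, Measure.map_apply (aux_eval_meas 0) MeasurableSet.univ, preimage_univ]
      rw [this, Measure.map_apply (aux_eval_meas 0) MeasurableSet.univ, preimage_univ, measure_univ]
    · conv_rhs => rw [hdec, Measure.map_sum (aux_eval_meas 0).aemeasurable]
      rw [Measure.map_sum (aux_eval_meas 0).aemeasurable]
      simp_rw [hη0]
    · rw [Measure.map_sum (aux_eval_meas 1).aemeasurable]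
      simp_rw [hη1]
      ext A hA
      rw [Measure.sum_apply _ hA, Measure.sum_apply _ hA, ENNReal.tsum_prod', ENNReal.tsum_comm]
      congr 1
      ext j
      simp only [Measure.smul_apply, smul_eq_mul]
      rw [ENNReal.tsum_mul_right]
      congr 1
      rw [← h1, Measure.map_apply (aux_eval_meas 1) (hfib j), ← measure_iUnion]
      · congr 1
        ext γ; simp [G]
      · intro i i' hij
        rw [Function.onFun, Set.disjoint_left]
        intro x hx hx'
        exact hij (congrArg Prod.fst (hx.symm.trans hx'))
      · exact fun i => hGf _
    · unfold transportCost
      rw [lintegral_sum_measure]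
      conv_rhs => rw [hdec, lintegral_sum_measure]
      refine ENNReal.tsum_le_tsum fun q => ?_
      have hmass : η q univ = π (G ⁻¹' {q}) := by
        have := congrArg (fun κ : Measure X => κ univ) (hη1 q)
        simpa [Measure.map_apply (aux_eval_meas 1) MeasurableSet.univ] using this
      have ae0 : ∀ᵐ γ ∂(η q), dist (eval 0 γ) (e q.1) < ε := by
        refine ae_of_ae_map (aux_eval_meas 0).aemeasurable (p := fun x => dist x (e q.1) < ε) ?_
        rw [hη0]
        refine (ae_map_iff (aux_eval_meas 0).aemeasurable
          (measurableSet_lt (measurable_id.dist measurable_const) measurable_const)).2 ?_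
        filter_upwards [ae_restrict_mem (hGf q)] with γ hγ
        have : G γ = q := hγ
        rw [← this]
        exact hg _
      have ae1 : ∀ᵐ γ ∂(η q), dist (eval 1 γ) (e q.2) < ε := by
        refine ae_of_ae_map (aux_eval_meas 1).aemeasurable (p := fun x => dist x (e q.2) < ε) ?_
        rw [hη1]
        refine Measure.ae_smul_measure ?_ _
        exact hbb q.2
      calc ∫⁻ γ, ENNReal.ofReal (dist (eval 0 γ) (eval 1 γ) ^ 2) ∂(η q)
          ≤ ∫⁻ γ, ENNReal.ofReal ((dist (e q.1) (e q.2) + 2 * ε) ^ 2) ∂(η q) := by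
            apply lintegral_mono_ae
            filter_upwards [ae0, ae1] with γ ha hb
            gcongr
            have := dist_triangle4 (eval 0 γ) (e q.1) (e q.2) (eval 1 γ)
            rw [dist_comm (e q.2)] at this
            linarith
        _ = ∫⁻ γ in G ⁻¹' {q}, ENNReal.ofReal ((dist (e q.1) (e q.2) + 2 * ε) ^ 2) ∂π := by
            rw [lintegral_const, lintegral_const, hmass, Measure.restrict_apply MeasurableSet.univ,
              univ_inter]
        _ ≤ _ := by
            apply lintegral_mono_ae
            filter_upwards [ae_restrict_mem (hGf q)] with γ hγ
            have hq : G γ = q := hγ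
            gcongr ENNReal.ofReal (?_ ^ 2)
            have h3 := hg (eval 0 γ)
            have h4 := hg (eval 1 γ)
            have hq1 : g (eval 0 γ) = q.1 := congrArg Prod.fst hq
            have hq2 : g (eval 1 γ) = q.2 := congrArg Prod.snd hq
            rw [hq1] at h3
            rw [hq2] at h4
            have := dist_triangle4 (e q.1) (eval 0 γ) (eval 1 γ) (e q.2)
            rw [dist_comm (e q.1) (eval 0 γ)] at this
            linarith

lemma aux_compact [ProperSpace X] (x₀ : X) (R : ℝ) :
    IsCompact {γ : Geo X | eval 0 γ ∈ closedBall x₀ R ∧ eval 1 γ ∈ closedBall x₀ R} := by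
  have hind : Topology.IsInducing (Subtype.val : Geo X → C(unitInterval, X)) :=
    Topology.IsInducing.subtypeVal
  have himg : (Subtype.val : Geo X → C(unitInterval, X)) ''
      {γ : Geo X | eval 0 γ ∈ closedBall x₀ R ∧ eval 1 γ ∈ closedBall x₀ R} =
      {γ | IsUnitGeodesic γ ∧ γ 0 ∈ closedBall x₀ R ∧ γ 1 ∈ closedBall x₀ R} := by
    ext γ
    constructor
    · rintro ⟨γ', h, rfl⟩
      exact ⟨γ'.2, h⟩
    · rintro ⟨h1, h2⟩
      exact ⟨⟨γ, h1⟩, h2, rfl⟩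
  refine hind.isCompact_iff.2 (Eq.subst (motive := fun S => IsCompact S) himg.symm ?_)
  have hd : ∀ γ : C(unitInterval, X), γ 0 ∈ closedBall x₀ R → γ 1 ∈ closedBall x₀ R →
      dist (γ 0) (γ 1) ≤ 2 * R := by
    intro γ h0 h1
    rw [mem_closedBall] at h0 h1
    linarith [dist_triangle_right (γ 0) (γ 1) x₀]
  have hlip : ∀ γ : C(unitInterval, X), IsUnitGeodesic γ → γ 0 ∈ closedBall x₀ R →
      γ 1 ∈ closedBall x₀ R → ∀ a b, dist (γ a) (γ b) ≤ 2 * R * dist a b := by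
    intro γ hγ h0 h1 a b
    rw [hγ a b, Subtype.dist_eq, Real.dist_eq, mul_comm]
    exact mul_le_mul_of_nonneg_right (hd γ h0 h1) (abs_nonneg _)
  apply ArzelaAscoli.isCompact_of_equicontinuous
  · have hpi : IsCompact {f : unitInterval → X | ∀ i, f i ∈ closedBall x₀ (3 * R)} :=
      isCompact_pi_infinite fun _ => isCompact_closedBall x₀ (3 * R)
    have hset : ContinuousMap.toFun ''
        {γ : C(unitInterval, X) | IsUnitGeodesic γ ∧ γ 0 ∈ closedBall x₀ R ∧ γ 1 ∈ closedBall x₀ R} =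
        {f : unitInterval → X | ∀ i, f i ∈ closedBall x₀ (3 * R)} ∩
        ({f | ∀ s t : unitInterval, dist (f s) (f t) = |(s : ℝ) - (t : ℝ)| * dist (f 0) (f 1)} ∩
          {f | f 0 ∈ closedBall x₀ R ∧ f 1 ∈ closedBall x₀ R}) := by
      ext f
      constructor
      · rintro ⟨γ, ⟨h1, h2, h3⟩, rfl⟩
        refine ⟨fun i => ?_, h1, h2, h3⟩
        have h4 := hlip γ h1 h2 h3 i 0
        have h5 : dist i 0 ≤ 1 := by
          rw [Subtype.dist_eq, Real.dist_eq]
          simp [abs_of_nonneg i.2.1, i.2.2]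
        have h6 : 0 ≤ R := dist_nonneg.trans h2
        have h7 : dist (γ 0) x₀ ≤ R := h2
        have h8 : dist (γ i) x₀ ≤ 3 * R := by
          have := dist_triangle (γ i) (γ 0) x₀
          nlinarith
        exact h8
      · rintro ⟨-, h1, h2, h3⟩
        have hc : Continuous f := by
          have : LipschitzWith (Real.toNNReal (dist (f 0) (f 1))) f := by
            apply LipschitzWith.of_dist_le_mul
            intro a b
            rw [h1 a b, Subtype.dist_eq, Real.dist_eq, mul_comm, Real.coe_toNNReal _ dist_nonneg]
          exact this.continuous
        exact ⟨⟨f, hc⟩, ⟨h1, h2, h3⟩, rfl⟩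
    rw [hset]
    apply hpi.inter_right
    apply IsClosed.inter
    · simp only [ofPred_forall]
      refine isClosed_iInter fun s => isClosed_iInter fun t => ?_
      exact isClosed_eq ((continuous_apply s).dist (continuous_apply t))
        (continuous_const.mul ((continuous_apply 0).dist (continuous_apply 1)))
    · exact (isClosed_closedBall.preimage (continuous_apply (A := fun _ : unitInterval => X) 0)).inter
        (isClosed_closedBall.preimage (continuous_apply (A := fun _ : unitInterval => X) 1))
  · apply Metric.equicontinuous_of_continuity_modulus (fun x => 2 * R * x)
    · have : Continuous (fun x : ℝ => 2 * R * x) := by fun_prop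
      simpa using this.tendsto 0
    · rintro a b ⟨γ, h1, h2, h3⟩
      exact hlip γ h1 h2 h3 a b

lemma aux_support {Y : Type*} [TopologicalSpace Y] [SecondCountableTopology Y]
    [MeasurableSpace Y] (μ : Measure Y) : μ (measSupport μ)ᶜ = 0 := by
  have : measSupport μ = μ.support := by
    ext x
    rw [Measure.mem_support_iff_forall]
    rfl
  rw [this, Measure.measure_compl_support]

lemma aux_lp [BorelSpace X] [SecondCountableTopology X] (ν : ProbabilityMeasure X)
    (νs : ℕ → ProbabilityMeasure X) (ε : ℕ → ℝ) (hε : ∀ n, 0 ≤ ε n)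
    (hlim : Tendsto ε atTop (𝓝 0))
    (h : ∀ n B, MeasurableSet B → (ν : Measure X) B ≤ (νs n : Measure X) (thickening (ε n) B)) :
    Tendsto νs atTop (𝓝 ν) := by
  have hd : Tendsto (fun n => LevyProkhorov.ofMeasure (νs n)) atTop
      (𝓝 (LevyProkhorov.ofMeasure ν)) := by
    rw [tendsto_iff_dist_tendsto_zero]
    refine squeeze_zero (fun _ => dist_nonneg) (fun n => ?_) hlim
    rw [dist_comm]
    change levyProkhorovDist (ν : Measure X) (νs n : Measure X) ≤ ε n
    refine levyProkhorovDist_le_of_forall_le _ _ (hε n) ?_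
    intro δ B hδ hB
    refine (h n B hB).trans (le_add_right (measure_mono (thickening_mono hδ.le _)))
  exact (LevyProkhorov.continuous_toMeasure_probabilityMeasure.tendsto _).comp hd

lemma aux_cost_lim [BorelSpace X] {L : Filter ℕ} (π : ProbabilityMeasure (Geo X))
    (πs : ℕ → ProbabilityMeasure (Geo X)) (hlim : Tendsto πs L (𝓝 π)) (D : ℝ)
    (h : ∀ᵐ γ ∂(π : Measure (Geo X)), dist (eval 0 γ) (eval 1 γ) ≤ D)
    (hn : ∀ n, ∀ᵐ γ ∂(πs n : Measure (Geo X)), dist (eval 0 γ) (eval 1 γ) ≤ D) :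
    Tendsto (fun n => transportCost (πs n : Measure (Geo X))) L
      (𝓝 (transportCost (π : Measure (Geo X)))) := by
  have hcont : Continuous (fun γ : Geo X =>
      Real.toNNReal (min (dist (eval 0 γ) (eval 1 γ) ^ 2) (D ^ 2))) :=
    continuous_real_toNNReal.comp (aux_cost_cont.min continuous_const)
  let f : BoundedContinuousFunction (Geo X) ℝ≥0 :=
    BoundedContinuousFunction.mkOfBound ⟨_, hcont⟩ (D ^ 2) (by
      intro a b
      rw [NNReal.dist_eq]
      simp only [ContinuousMap.coe_mk]
      rw [Real.coe_toNNReal _ (by positivity), Real.coe_toNNReal _ (by positivity), abs_le]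
      have h1 : 0 ≤ min (dist (eval 0 a) (eval 1 a) ^ 2) (D ^ 2) := by positivity
      have h2 : 0 ≤ min (dist (eval 0 b) (eval 1 b) ^ 2) (D ^ 2) := by positivity
      have h3 := min_le_right (dist (eval 0 a) (eval 1 a) ^ 2) (D ^ 2)
      have h4 := min_le_right (dist (eval 0 b) (eval 1 b) ^ 2) (D ^ 2)
      constructor <;> linarith)
  have key : ∀ η : Measure (Geo X), (∀ᵐ γ ∂η, dist (eval 0 γ) (eval 1 γ) ≤ D) →
      transportCost η = ∫⁻ γ, (f γ : ℝ≥0∞) ∂η := by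
    intro η hη
    refine lintegral_congr_ae ?_
    filter_upwards [hη] with γ hγ
    change _ = ENNReal.ofReal (min (dist (eval 0 γ) (eval 1 γ) ^ 2) (D ^ 2))
    rw [min_eq_left]
    gcongr
  rw [key _ h]
  simp_rw [fun n => key _ (hn n)]
  exact (ProbabilityMeasure.tendsto_iff_forall_lintegral_tendsto.1 hlim) f

lemma aux_main
    [CompleteSpace X] [TopologicalSpace.SeparableSpace X] [ProperSpace X] [BorelSpace X]
    (hX : IsGeodesicSpace X) (m : Measure X)
    (hm_bdd : ∀ s : Set X, Bornology.IsBounded s → m s ≠ ⊤)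
    (hm_supp : ∀ x : X, ∀ r : ℝ, 0 < r → 0 < m (ball x r))
    (K N : ℝ) (hN : 1 ≤ N) (hCD : IsCDStar K N m) (hGT : GoodTransport m)
    (μ ν : Measure X) (hμp : IsProbabilityMeasure μ) (hνp : IsProbabilityMeasure ν)
    (hμ2 : HasFiniteSecondMoment μ) (hν2 : HasFiniteSecondMoment ν)
    (hμsupp : Bornology.IsBounded (measSupport μ))
    (hνsupp : Bornology.IsBounded (measSupport ν))
    (C : ℝ) (hC : 0 < C) (hμC : μ ≤ ENNReal.ofReal C • m) :
    ∃ π : Measure (Geo X), IsOptGeo μ ν π ∧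
      ∀ t : unitInterval, (t : ℝ) < 1 → π.map (eval t) ≪ m := by
  have hsec : SecondCountableTopology X := UniformSpace.secondCountable_of_separable X
  obtain ⟨x₀⟩ : Nonempty X := nonempty_of_isProbabilityMeasure μ
  have hne : Nonempty X := ⟨x₀⟩
  have hfc : IsFiniteMeasureOnCompacts m := ⟨fun k hk => (hm_bdd k hk.isBounded).lt_top⟩
  have hsf : SigmaFinite m := inferInstance
  set s := measSupport μ ∪ measSupport ν with hs_def
  have hs : Bornology.IsBounded s := hμsupp.union hνsupp
  have hμs : μ sᶜ = 0 :=
    measure_mono_null (compl_subset_compl.2 subset_union_left) (aux_support μ)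
  have hνs : ν sᶜ = 0 :=
    measure_mono_null (compl_subset_compl.2 subset_union_right) (aux_support ν)
  obtain ⟨R, hR⟩ := (hs.thickening (δ := 2)).subset_closedBall x₀
  have hsR : s ⊆ closedBall x₀ R := (self_subset_thickening (by norm_num) s).trans hR
  have hR0 : 0 ≤ R := by
    by_contra hR0
    rw [closedBall_eq_empty.2 (not_le.1 hR0), subset_empty_iff] at hsR
    rw [hsR, compl_empty, measure_univ] at hμs
    exact one_ne_zero hμs
  set D := 2 * R with hDdef
  have hD : ∀ x ∈ closedBall x₀ R, ∀ y ∈ closedBall x₀ R, dist x y ≤ D := by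
    intro x hx y hy
    rw [mem_closedBall] at hx hy
    linarith [dist_triangle_right x y x₀]
  have hμR : μ (closedBall x₀ R)ᶜ = 0 := measure_mono_null (compl_subset_compl.2 hsR) hμs
  have hνR : ν (closedBall x₀ R)ᶜ = 0 := measure_mono_null (compl_subset_compl.2 hsR) hνs
  set ε : ℕ → ℝ := fun n => 1 / ((n : ℝ) + 1) with hεdef
  have hε0 : ∀ n, 0 < ε n := fun n => by positivity
  have hε1 : ∀ n, ε n ≤ 1 := fun n => by
    rw [hεdef]
    simp only
    rw [div_le_one (by positivity)]
    linarith [(Nat.cast_nonneg n : (0 : ℝ) ≤ n)]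
  have hεlim : Tendsto ε atTop (𝓝 0) := tendsto_one_div_add_atTop_nhds_zero_nat
  choose νs hνp' hνac hνth hνle hνplan using fun n =>
    aux_approx m hm_bdd hm_supp K N hCD ν s hs hνs (ε n) (hε0 n)
  have hνsR : ∀ n, νs n (closedBall x₀ R)ᶜ = 0 := fun n => by
    refine measure_mono_null (compl_subset_compl.2 ?_) (hνth n)
    exact (thickening_mono (by linarith [hε1 n]) s).trans hR
  choose πs hπs _ using fun n => hCD μ (νs n) hμp (hνp' n)
    ⟨closedBall x₀ R, isBounded_closedBall, hμR, hνsR n⟩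
  have hπp : ∀ n, IsProbabilityMeasure (πs n) := fun n => (hπs n).1
  let P : ℕ → ProbabilityMeasure (Geo X) := fun n => ⟨πs n, hπp n⟩
  set 𝒦 := {γ : Geo X | eval 0 γ ∈ closedBall x₀ R ∧ eval 1 γ ∈ closedBall x₀ R} with h𝒦
  have h𝒦c : IsCompact 𝒦 := aux_compact x₀ R
  have hPK : ∀ n, πs n 𝒦ᶜ = 0 := by
    intro n
    have e0 : ∀ᵐ γ ∂(πs n), eval 0 γ ∈ closedBall x₀ R :=
      ae_of_ae_map (aux_eval_meas 0).aemeasurable (p := fun x => x ∈ closedBall x₀ R)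
        (by rw [(hπs n).2.1]; exact hμR)
    have e1 : ∀ᵐ γ ∂(πs n), eval 1 γ ∈ closedBall x₀ R :=
      ae_of_ae_map (aux_eval_meas 1).aemeasurable (p := fun x => x ∈ closedBall x₀ R)
        (by rw [(hπs n).2.2.1]; exact hνsR n)
    exact e0.and e1
  have hcomp := isCompact_setOfPred_probabilityMeasure_mass_eq_compl_isCompact_le
    (E := Geo X) (u := fun _ => 0) (K := fun _ => 𝒦) tendsto_const_nhds (fun _ => h𝒦c)
    (Or.inl inferInstance)
  obtain ⟨Q, -, hQ⟩ := hcomp.ultrafilter_le_nhds ((hyperfilter ℕ).map P) (by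
    rw [le_principal_iff]
    refine Filter.mem_map.2 (Filter.univ_mem' fun n k => ?_)
    have : (P n : Measure (Geo X)) 𝒦ᶜ = 0 := hPK n
    rw [ProbabilityMeasure.coeFn_def]
    simp [this])
  have hlim : Tendsto P (hyperfilter ℕ : Filter ℕ) (𝓝 Q) := hQ
  have hle : (hyperfilter ℕ : Filter ℕ) ≤ atTop := by
    rw [← Nat.cofinite_eq_atTop]; exact hyperfilter_le_cofinite
  have hmap : ∀ t : unitInterval, Tendsto (fun n => (P n).map (aux_eval_meas t).aemeasurable)
      (hyperfilter ℕ : Filter ℕ) (𝓝 (Q.map (aux_eval_meas t).aemeasurable)) := fun t =>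
    ProbabilityMeasure.tendsto_map_of_tendsto_of_continuous P Q hlim (aux_eval_cont t)
  let μP : ProbabilityMeasure X := ⟨μ, hμp⟩
  let νP : ProbabilityMeasure X := ⟨ν, hνp⟩
  let νsP : ℕ → ProbabilityMeasure X := fun n => ⟨νs n, hνp' n⟩
  have hQ0 : (Q : Measure (Geo X)).map (eval 0) = μ := by
    have h1 : Tendsto (fun n => (P n).map (aux_eval_meas 0).aemeasurable)
        (hyperfilter ℕ : Filter ℕ) (𝓝 μP) := by
      refine tendsto_const_nhds.congr fun n => ?_
      exact Subtype.ext (hπs n).2.1.symm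
    exact congrArg (fun κ : ProbabilityMeasure X => (κ : Measure X)) (tendsto_nhds_unique (hmap 0) h1)
  have hQ1 : (Q : Measure (Geo X)).map (eval 1) = ν := by
    have h1 : Tendsto νsP atTop
        (𝓝 νP) :=
      aux_lp νP νsP (fun n => 2 * ε n) (fun n => by linarith [hε0 n])
        (by simpa using hεlim.const_mul 2) hνle
    have h2 : Tendsto (fun n => (P n).map (aux_eval_meas 1).aemeasurable)
        (hyperfilter ℕ : Filter ℕ) (𝓝 νP) := by
      refine (h1.mono_left hle).congr fun n => ?_
      exact Subtype.ext (hπs n).2.2.1.symm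
    exact congrArg (fun κ : ProbabilityMeasure X => (κ : Measure X)) (tendsto_nhds_unique (hmap 1) h2)
  refine ⟨Q, ⟨inferInstance, hQ0, hQ1, ?_⟩, ?_⟩
  · intro π' hπ' h0 h1
    have hcl := aux_cost_lim Q P hlim D
      (aux_cost_le (Q : Measure (Geo X)) _ D hD (by rw [hQ0]; exact hμR) (by rw [hQ1]; exact hνR)).1
      (fun n => (aux_cost_le (πs n) _ D hD (by rw [(hπs n).2.1]; exact hμR)
        (by rw [(hπs n).2.2.1]; exact hνsR n)).1)
    have hD' := (aux_cost_le π' _ D hD (by rw [h0]; exact hμR) (by rw [h1]; exact hνR)).1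
    have hbound : ∀ n, transportCost (P n : Measure (Geo X)) ≤
        transportCost π' + ENNReal.ofReal (ε n * (8 * D + 16)) := by
      intro n
      obtain ⟨π'', hp'', h0'', h1'', hc''⟩ := hνplan n π' hπ' (by rw [h0]; exact hμs) h1
      refine ((hπs n).2.2.2 π'' hp'' (h0''.trans h0) h1'').trans (hc''.trans ?_)
      calc ∫⁻ γ, ENNReal.ofReal ((dist (eval 0 γ) (eval 1 γ) + 4 * ε n) ^ 2) ∂π'
          ≤ ∫⁻ γ, (ENNReal.ofReal (dist (eval 0 γ) (eval 1 γ) ^ 2) +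
              ENNReal.ofReal (ε n * (8 * D + 16))) ∂π' := by
            apply lintegral_mono_ae
            filter_upwards [hD'] with γ hγ
            have hD0 : 0 ≤ D := dist_nonneg.trans hγ
            have := hε0 n
            have := hε1 n
            rw [← ENNReal.ofReal_add (by positivity) (by positivity)]
            apply ENNReal.ofReal_le_ofReal
            nlinarith [mul_le_mul_of_nonneg_left hγ (hε0 n).le,
              mul_le_mul_of_nonneg_left (hε1 n) (hε0 n).le]
        _ = _ := by
            rw [lintegral_add_right _ measurable_const, lintegral_const, measure_univ, mul_one]
            rfl
    have hlim2 : Tendsto (fun n => transportCost π' + ENNReal.ofReal (ε n * (8 * D + 16)))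
        (hyperfilter ℕ : Filter ℕ) (𝓝 (transportCost π')) := by
      have h3 : Tendsto (fun n => ε n * (8 * D + 16)) atTop (𝓝 0) := by
        simpa using hεlim.mul_const (8 * D + 16)
      have h4 := (ENNReal.tendsto_ofReal h3).const_add (transportCost π')
      simp only [ENNReal.ofReal_zero, add_zero] at h4
      exact h4.mono_left hle
    exact le_of_tendsto_of_tendsto' hcl hlim2 hbound
  · intro t ht
    set c := ENNReal.ofReal ((1 - (t : ℝ)) / Real.cosh (D * Real.sqrt (-K / (N + 1)))) ^ (N + 1)
      with hc
    have hb0 : 0 < ENNReal.ofReal ((1 - (t : ℝ)) / Real.cosh (D * Real.sqrt (-K / (N + 1)))) :=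
      ENNReal.ofReal_pos.2 (div_pos (by linarith) (Real.cosh_pos _))
    have hc0 : c ≠ 0 := (ENNReal.rpow_pos hb0 ENNReal.ofReal_ne_top).ne'
    have hct : c ≠ ⊤ := ENNReal.rpow_ne_top_of_nonneg (by linarith) ENNReal.ofReal_ne_top
    have hU : ∀ U : Set X, IsOpen U →
        (Q : Measure (Geo X)).map (eval t) U ≤ c⁻¹ * (ENNReal.ofReal C * m U) := by
      intro U hU
      have h1 := ProbabilityMeasure.le_liminf_measure_open_of_tendsto (hmap t) hU
      refine h1.trans ?_
      refine (Filter.liminf_le_liminf (v := fun _ => c⁻¹ * (ENNReal.ofReal C * m U))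
        (Filter.Eventually.of_forall fun n => ?_)).trans (Filter.liminf_const _).le
      have h2 := aux_density m K N hN hCD hGT μ (νs n) _ isBounded_closedBall hμR (hνsR n) D hD C hC
        hμC (hνac n) (πs n) (hπs n) t U hU.measurableSet
      rw [← hc] at h2
      rw [mul_comm, ← div_eq_mul_inv, ENNReal.le_div_iff_mul_le (Or.inl hc0) (Or.inl hct), mul_comm]
      exact h2
    intro A hA
    by_contra hpos
    have hk0 : c⁻¹ * ENNReal.ofReal C ≠ 0 :=
      mul_ne_zero (ENNReal.inv_ne_zero.2 hct) (ENNReal.ofReal_pos.2 hC).ne'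
    have hkt : c⁻¹ * ENNReal.ofReal C ≠ ⊤ :=
      ENNReal.mul_ne_top (ENNReal.inv_ne_top.2 hc0) ENNReal.ofReal_ne_top
    have hrp : 0 < (Q : Measure (Geo X)).map (eval t) A / (c⁻¹ * ENNReal.ofReal C) :=
      ENNReal.div_pos hpos hkt
    obtain ⟨U, hAU, hUo, hUlt⟩ := A.exists_isOpen_lt_of_lt _ (hA ▸ hrp : m A < _)
    have h3 := (measure_mono hAU).trans (hU U hUo)
    rw [← mul_assoc] at h3
    rw [ENNReal.lt_div_iff_mul_lt (Or.inl hk0) (Or.inl hkt), mul_comm] at hUlt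
    exact absurd h3 (not_le.2 hUlt)


end Aux

/-- **Lemma 3.2**: if `μ ≤ C·m` and `μ,ν` have bounded supports, there is an optimal geodesic
plan whose interpolants are absolutely continuous for every `t < 1`. -/
theorem exists_plan_with_ac_interpolants
    [CompleteSpace X] [TopologicalSpace.SeparableSpace X] [ProperSpace X] [BorelSpace X]
    (hX : IsGeodesicSpace X) (m : Measure X)
    (hm_bdd : ∀ s : Set X, Bornology.IsBounded s → m s ≠ ⊤)
    (hm_supp : ∀ x : X, ∀ r : ℝ, 0 < r → 0 < m (ball x r))
    (K N : ℝ) (hN : 1 ≤ N) (hCD : IsCDStar K N m) (hGT : GoodTransport m)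
    (μ ν : Measure X) (hμp : IsProbabilityMeasure μ) (hνp : IsProbabilityMeasure ν)
    (hμ2 : HasFiniteSecondMoment μ) (hν2 : HasFiniteSecondMoment ν)
    (hμsupp : Bornology.IsBounded (measSupport μ))
    (hνsupp : Bornology.IsBounded (measSupport ν))
    (C : ℝ) (hC : 0 < C) (hμC : μ ≤ ENNReal.ofReal C • m) :
    ∃ π : Measure (Geo X), IsOptGeo μ ν π ∧
      ∀ t : unitInterval, (t : ℝ) < 1 → π.map (eval t) ≪ m := by
  exact aux_main hX m hm_bdd hm_supp K N hN hCD hGT μ ν hμp hνp hμ2 hν2 hμsupp hνsupp C hC hμC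

end
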